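/- arXiv:1102.4494 — 5 statements merged into one kernel-verified Lean document; each statement's English description precedes it below -/
import Mathlib

section
/- Let H be a complex Hilbert space, A a bounded positive operator on H, λ ≥ 0 a real number, and h a bounded operator with 0 ≤ h ≤ 1. Suppose (e_k)_{k∈ℕ} is a sequence of orthogonal projections on H converging to h in the weak operator topology and satisfying e_k A e_k ≤ λ · e_k for every k. Then h A h ≤ λ · h. -/
open scoped InnerProductSpace

/-- The Fenchel-type inequality for the quadratic form of a positive operator. -/
theorem ContinuousLinearMap.IsPositive.two_mul_re_inner_le {H : Type*} [NormedAddCommGroup H]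
    [InnerProductSpace ℂ H] {A : H →L[ℂ] H} (hA : A.IsPositive) (u v : H) :
    2 * (⟪u, A v⟫_ℂ).re ≤ (⟪A u, u⟫_ℂ).re + (⟪A v, v⟫_ℂ).re := by
  have h := hA.re_inner_nonneg_left (u - v)
  have huv : (⟪A u, v⟫_ℂ).re = (⟪u, A v⟫_ℂ).re := by rw [hA.inner_left_eq_inner_right]
  have hvu : (⟪A v, u⟫_ℂ).re = (⟪u, A v⟫_ℂ).re := inner_re_symm (𝕜 := ℂ) _ _
  simp only [map_sub, inner_sub_left, inner_sub_right, RCLike.re_to_complex] at h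
  linarith

/-- If `A ≥ 0`, `0 ≤ h ≤ 1`, `(e_k)` is a sequence of orthogonal projections converging to `h`
in the weak operator topology with `e_k A e_k ≤ λ e_k` for all `k`, then `h A h ≤ λ h`. -/
theorem stmt2 {H : Type*} [NormedAddCommGroup H] [InnerProductSpace ℂ H] [CompleteSpace H]
    (A h : H →L[ℂ] H) (lam : ℝ) (hlam : 0 ≤ lam)
    (hA : A.IsPositive) (hh0 : h.IsPositive) (hh1 : (1 - h).IsPositive)
    (e : ℕ → (H →L[ℂ] H))
    (heSA : ∀ k, IsSelfAdjoint (e k)) (heIdem : ∀ k, IsIdempotentElem (e k))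
    (hWOT : ∀ ξ η : H, Filter.Tendsto (fun k => ⟪(e k) ξ, η⟫_ℂ) Filter.atTop
      (nhds ⟪h ξ, η⟫_ℂ))
    (hineq : ∀ k, (lam • (e k) - (e k) ∘L A ∘L (e k)).IsPositive) :
    (lam • h - h ∘L A ∘L h).IsPositive := by
  have hconj : IsSelfAdjoint (h ∘L A ∘L h) := by
    have := hA.isSelfAdjoint.conjugate h
    rwa [hh0.isSelfAdjoint.star_eq, mul_assoc] at this
  have key (ξ : H) : (⟪A (h ξ), h ξ⟫_ℂ).re ≤ lam * (⟪h ξ, ξ⟫_ℂ).re := by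
    have bound (k : ℕ) : 2 * (⟪e k ξ, A (h ξ)⟫_ℂ).re ≤
        lam * (⟪e k ξ, ξ⟫_ℂ).re + (⟪A (h ξ), h ξ⟫_ℂ).re := by
      have h₁ := hA.two_mul_re_inner_le (e k ξ) (h ξ)
      have h₂ := (hineq k).re_inner_nonneg_left ξ
      have h₃ : ⟪e k (A (e k ξ)), ξ⟫_ℂ = ⟪A (e k ξ), e k ξ⟫_ℂ := (heSA k).isSymmetric _ _
      simp [inner_sub_left, inner_smul_left_eq_smul, h₃] at h₂
      linarith
    have hre (η : H) := (Complex.continuous_re.tendsto _).comp (hWOT ξ η)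
    have hlim := le_of_tendsto_of_tendsto' ((hre (A (h ξ))).const_mul 2)
      (((hre ξ).const_mul lam).add_const (⟪A (h ξ), h ξ⟫_ℂ).re) bound
    have hsymm : (⟪h ξ, A (h ξ)⟫_ℂ).re = (⟪A (h ξ), h ξ⟫_ℂ).re := inner_re_symm (𝕜 := ℂ) _ _
    linarith
  refine ContinuousLinearMap.isPositive_def'.2
    ⟨((IsSelfAdjoint.all lam).smul hh0.isSelfAdjoint).sub hconj, fun ξ => ?_⟩
  have h₃ : ⟪h (A (h ξ)), ξ⟫_ℂ = ⟪A (h ξ), h ξ⟫_ℂ := hh0.inner_left_eq_inner_right _ _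
  simp [ContinuousLinearMap.reApplyInnerSelf_apply, inner_sub_left, inner_smul_left_eq_smul, h₃]
  exact key ξ
end

section
/- Let H be a complex Hilbert space and h a bounded self-adjoint operator on H with 0 ≤ h ≤ 1. Then there exist an orthogonal projection e on H and a bounded positive operator g on H such that ‖g‖ ≤ 2, g h = h g = e, and 1 − e ≤ 2 · (1 − h). (Explicitly, e is the spectral projection of h for the interval [1/2, 1] and g = ∫_{1/2}^{1} s^{-1} de_s in the spectral decomposition h = ∫_0^1 s de_s.) -/
/-- If `d` is self-adjoint and `d * p = 0` with `p` self-adjoint, there is an orthogonal projection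
which is annihilated by `d` and acts as the identity on the range of `p`. -/
theorem exists_projection_of_mul_eq_zero {H : Type*} [NormedAddCommGroup H]
    [InnerProductSpace ℂ H] [CompleteSpace H] {d p : H →L[ℂ] H} (hd : IsSelfAdjoint d)
    (hp : IsSelfAdjoint p) (hdp : d * p = 0) :
    ∃ e : H →L[ℂ] H, IsSelfAdjoint e ∧ IsIdempotentElem e ∧ d * e = 0 ∧ e * d = 0 ∧
      e * p = p ∧ p * e = p := by
  let K : Submodule ℂ H := LinearMap.ker (d : H →ₗ[ℂ] H)
  have hK : IsClosed (K : Set H) := d.isClosed_ker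
  have : CompleteSpace K := hK.completeSpace_coe
  have he : IsSelfAdjoint K.starProjection := isSelfAdjoint_starProjection K
  have hde : d * K.starProjection = 0 := by
    ext x
    exact LinearMap.mem_ker.mp (K.starProjection_apply_mem x)
  have hep : K.starProjection * p = p := by
    ext x
    refine Submodule.starProjection_eq_self_iff.mpr (LinearMap.mem_ker.mpr ?_)
    exact DFunLike.congr_fun hdp x
  refine ⟨K.starProjection, he, K.isIdempotentElem_starProjection, hde, ?_, hep, ?_⟩
  · simpa [he.star_eq, hd.star_eq] using congrArg star hde
  · simpa [he.star_eq, hp.star_eq] using congrArg star hep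

/-- For a bounded self-adjoint operator `h` with `0 ≤ h ≤ 1` on a complex Hilbert space,
there are an orthogonal projection `e` (the spectral projection of `h` for `[1/2, 1]`) and a
positive operator `g` with `‖g‖ ≤ 2`, `g h = h g = e` and `1 − e ≤ 2 (1 − h)`. -/
theorem stmt3 {H : Type*} [NormedAddCommGroup H] [InnerProductSpace ℂ H] [CompleteSpace H]
    (h : H →L[ℂ] H) (hh0 : h.IsPositive) (hh1 : (1 - h).IsPositive) :
    ∃ e g : H →L[ℂ] H, IsSelfAdjoint e ∧ IsIdempotentElem e ∧ g.IsPositive ∧ ‖g‖ ≤ 2 ∧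
      g ∘L h = e ∧ h ∘L g = e ∧ ((2 : ℝ) • (1 - h) - (1 - e)).IsPositive := by
  have hsa : IsSelfAdjoint h := hh0.isSelfAdjoint
  have hpos (x : ℝ) : max x (1 / 2) ≠ 0 := (lt_of_lt_of_le (by norm_num) (le_max_right _ _)).ne'
  have hfc : Continuous fun x : ℝ ↦ (max x (1 / 2))⁻¹ :=
    (continuous_id.max continuous_const).inv₀ hpos
  let d : H →L[ℂ] H := cfc (fun x : ℝ ↦ max (1 / 2 - x) 0) h
  let p : H →L[ℂ] H := cfc (fun x : ℝ ↦ max (x - 1 / 2) 0) h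
  let b : H →L[ℂ] H := cfc (fun x : ℝ ↦ max x (1 / 2)) h
  let c : H →L[ℂ] H := cfc (fun x : ℝ ↦ (max x (1 / 2))⁻¹) h
  have hd0 : 0 ≤ d := cfc_nonneg fun x _ ↦ le_max_right _ _
  have hc0 : 0 ≤ c := cfc_nonneg fun x _ ↦
    inv_nonneg.mpr (le_trans (by norm_num) (le_max_right x (1 / 2)))
  have hc2 : ‖c‖ ≤ 2 := norm_cfc_le (by norm_num) fun x _ ↦ by
    have hx : (1 / 2 : ℝ) ≤ max x (1 / 2) := le_max_right _ _
    rw [Real.norm_of_nonneg (inv_nonneg.mpr (by linarith))]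
    exact inv_le_of_inv_le₀ (by norm_num) (by linarith)
  have hdp : d * p = 0 := by
    rw [← cfc_mul _ _ h (by fun_prop) (by fun_prop), ← cfc_zero ℝ h]
    refine cfc_congr fun x _ ↦ ?_
    change max (1 / 2 - x) 0 * max (x - 1 / 2) 0 = 0
    grind
  have hcb : c * b = 1 := by
    rw [← cfc_mul _ _ h hfc.continuousOn (by fun_prop), ← cfc_one ℝ h]
    exact cfc_congr fun x _ ↦ inv_mul_cancel₀ (hpos x)
  have hbc : b * c = 1 := (cfc_commute_cfc _ _ h).eq.trans hcb
  have hbd : h = b - d := by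
    rw [← cfc_sub _ _ h (by fun_prop) (by fun_prop)]
    conv_lhs => rw [← cfc_id ℝ h]
    refine cfc_congr fun x _ ↦ ?_
    grind
  have hbp : b = (1 / 2 : ℝ) • 1 + p := by
    have hconst : (1 / 2 : ℝ) • (1 : H →L[ℂ] H) = cfc (fun _ : ℝ ↦ (1 / 2 : ℝ)) h := by
      rw [cfc_const _ h, Algebra.algebraMap_eq_smul_one]
    rw [hconst, ← cfc_add h _ _ (by fun_prop) (by fun_prop)]
    refine cfc_congr fun x _ ↦ ?_
    grind
  obtain ⟨e, he, hee, hde, hed, hep, hpe⟩ :=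
    exists_projection_of_mul_eq_zero (IsSelfAdjoint.of_nonneg hd0) (cfc_predicate _ h) hdp
  have hbe : b * e = e * b := by
    rw [hbp, add_mul, mul_add, hep, hpe, smul_one_mul, mul_smul_one]
  have hce : c * e = e * c := by
    calc c * e = c * (e * b) * c := by rw [mul_assoc, mul_assoc, hbc, mul_one]
      _ = e * c := by rw [← hbe, ← mul_assoc, hcb, one_mul]
  have hhe : h * e = e * b := by rw [hbd, sub_mul, hde, sub_zero, hbe]
  have heh : e * h = e * b := by rw [hbd, mul_sub, hed, sub_zero]
  have hg : c * e = e * c * e := by rw [← hce, mul_assoc, hee.eq]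
  refine ⟨e, c * e, he, hee, ?_, ?_, ?_, ?_, ?_⟩
  · rw [← ContinuousLinearMap.nonneg_iff_isPositive, hg]
    exact he.conjugate_nonneg hc0
  · have he1 : ‖e‖ ≤ 1 := (IsStarProjection.mk hee he).norm_le
    calc ‖c * e‖ ≤ ‖c‖ * ‖e‖ := norm_mul_le _ _
      _ ≤ 2 * 1 := by gcongr
      _ = 2 := mul_one 2
  · change c * e * h = e
    rw [mul_assoc, heh, ← hbe, ← mul_assoc, hcb, one_mul]
  · change h * (c * e) = e
    rw [hce, ← mul_assoc, hhe, mul_assoc, hbc, mul_one]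
  · have hkey : (2 : ℝ) • (1 - h) - (1 - e) = (2 : ℝ) • (d + e * (1 - h) * e) := by
      have hmid : e * (1 - h) * e = (1 / 2 : ℝ) • e - p := by
        rw [mul_sub, mul_one, sub_mul, hee.eq, mul_assoc, hhe, ← mul_assoc, hee.eq, hbp, mul_add,
          hep, mul_smul_one]
        module
      rw [hmid, hbd, hbp]
      module
    rw [hkey, ← ContinuousLinearMap.nonneg_iff_isPositive]
    rw [← ContinuousLinearMap.nonneg_iff_isPositive] at hh1
    exact smul_nonneg (by norm_num) (add_nonneg hd0 (he.conjugate_nonneg hh1))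
end

section
/- Let H be a complex Hilbert space, A a bounded positive operator on H, λ ≥ 0 a real number, and h a bounded operator with 0 ≤ h ≤ 1 such that h A h ≤ λ · h. Then there exists an orthogonal projection e on H with 1 − e ≤ 2 · (1 − h) and e A e ≤ 2λ · e. -/
/-- A continuous substitute for the spectral projection of `h` on `(1/2, ∞)`: `k` is the positive
part of `h - 1/2`, and it factors through `h`. -/
theorem IsSelfAdjoint.exists_posPart_sub_half_factorization {H : Type*} [NormedAddCommGroup H]
    [InnerProductSpace ℂ H] [CompleteSpace H] {h : H →L[ℂ] H} (hs : IsSelfAdjoint h) :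
    ∃ k g : H →L[ℂ] H, IsSelfAdjoint k ∧ IsSelfAdjoint g ∧ Commute k h ∧ k = h * g ∧
      h - (1 / 2 : ℝ) • (1 : H →L[ℂ] H) ≤ k ∧ g * h * g ≤ (2 : ℝ) • (k * k) := by
  set f : ℝ → ℝ := fun t => max (t - 1 / 2) 0 with hf
  set φ : ℝ → ℝ := fun t => max (t - 1 / 2) 0 / max t (1 / 2) with hφ
  have hfc : Continuous f := by fun_prop
  have hφc : Continuous φ := by
    refine Continuous.div (by fun_prop) (by fun_prop) fun t => ?_
    have := le_max_right t (1 / 2 : ℝ)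
    positivity
  have hφ0 : ∀ t ≤ 1 / 2, φ t = 0 := fun t ht => by
    simp only [hφ, max_eq_right (sub_nonpos.2 ht), zero_div]
  have hkey : ∀ t, f t = t * φ t := fun t => by
    rcases le_total t (1 / 2) with ht | ht
    · rw [hφ0 t ht, mul_zero]
      exact max_eq_right (sub_nonpos.2 ht)
    · simp only [hf, hφ]
      rw [max_eq_left ht]
      field_simp
  refine ⟨cfc f h, cfc φ h, cfc_predicate f h, cfc_predicate φ h,
    (Commute.refl h).cfc_real f, ?_, ?_, ?_⟩
  · conv_rhs => enter [1]; rw [← cfc_id' ℝ h]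
    rw [← cfc_mul _ _ h (by fun_prop) hφc.continuousOn]
    exact cfc_congr fun t _ => hkey t
  · have : h - (1 / 2 : ℝ) • (1 : H →L[ℂ] H) = cfc (fun t : ℝ => t - 1 / 2) h := by
      rw [cfc_sub (fun t : ℝ => t) (fun _ => 1 / 2) h, cfc_id' ℝ h, cfc_const _ h,
        Algebra.algebraMap_eq_smul_one]
    rw [this]
    exact cfc_mono (fun t _ => le_max_left _ _) (by fun_prop) hfc.continuousOn
  · have e1 : cfc φ h * h * cfc φ h = cfc (fun t => φ t * t * φ t) h := by
      rw [cfc_mul (fun t => φ t * t) φ h (by fun_prop) hφc.continuousOn,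
        cfc_mul φ (fun t => t) h hφc.continuousOn (by fun_prop), cfc_id' ℝ h]
    have e2 : (2 : ℝ) • (cfc f h * cfc f h) = cfc (fun t => (2 : ℝ) • (f t * f t)) h := by
      rw [cfc_smul _ _ h (by fun_prop), cfc_mul f f h hfc.continuousOn hfc.continuousOn]
    rw [e1, e2]
    refine cfc_mono (fun t _ => ?_) (by fun_prop) (by fun_prop)
    rcases le_total t (1 / 2) with ht | ht
    · simp [hkey, hφ0 t ht]
    · rw [hkey, smul_eq_mul]
      nlinarith [mul_nonneg (sq_nonneg (φ t))
        (mul_nonneg (by linarith : 0 ≤ t) (by linarith : 0 ≤ 2 * t - 1))]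

/-- If `A ≥ 0`, `0 ≤ h ≤ 1` and `h A h ≤ λ h`, then there is an orthogonal projection `e`
with `1 − e ≤ 2 (1 − h)` and `e A e ≤ 2 λ e`. -/
theorem stmt4 {H : Type*} [NormedAddCommGroup H] [InnerProductSpace ℂ H] [CompleteSpace H]
    (A h : H →L[ℂ] H) (lam : ℝ) (hlam : 0 ≤ lam)
    (hA : A.IsPositive) (hh0 : h.IsPositive) (hh1 : (1 - h).IsPositive)
    (hAh : (lam • h - h ∘L A ∘L h).IsPositive) :
    ∃ e : H →L[ℂ] H, IsSelfAdjoint e ∧ IsIdempotentElem e ∧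
      ((2 : ℝ) • (1 - h) - (1 - e)).IsPositive ∧
      ((2 * lam) • e - e ∘L A ∘L e).IsPositive := by
  have hs := hh0.isSelfAdjoint
  obtain ⟨k, g, hk, hg, hkh, hkg, hle, hgle⟩ := hs.exists_posPart_sub_half_factorization
  have sym : ∀ {T : H →L[ℂ] H}, IsSelfAdjoint T → ∀ x y, inner ℂ (T x) y = inner ℂ x (T y) :=
    fun hT => hT.isSymmetric
  set M : Submodule ℂ H := k.range.topologicalClosure with hM
  have hmem : ∀ v, v ∈ Mᗮ ↔ k v = 0 := fun v => by
    rw [hM, Submodule.orthogonal_closure, ContinuousLinearMap.orthogonal_range, hk.adjoint_eq]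
    rfl
  have hM_le : ∀ u ∈ M, (inner ℂ (A u) u).re ≤ 2 * lam * ‖u‖ ^ 2 := by
    intro u hu
    have hclosed : IsClosed {u : H | (inner ℂ (A u) u).re ≤ 2 * lam * ‖u‖ ^ 2} :=
      isClosed_le (by fun_prop) (by fun_prop)
    refine closure_minimal ?_ hclosed hu
    rintro _ ⟨w, rfl⟩
    have h1 := hAh.re_inner_nonneg_left (g w)
    have h2 := ((ContinuousLinearMap.le_def _ _).1 hgle).re_inner_nonneg_left w
    have hkw : k w = h (g w) := by rw [hkg]; rfl
    simp only [sub_apply, smul_apply,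
      ContinuousLinearMap.comp_apply, mul_apply_eq_comp, inner_sub_left,
      inner_smul_left_eq_smul, map_sub, RCLike.re_to_complex, Complex.smul_re, smul_eq_mul] at h1 h2
    rw [sym hs (A _), ← hkw] at h1
    rw [sym hg, sym hk, ← RCLike.re_to_complex, ← RCLike.re_to_complex,
      inner_self_eq_norm_sq] at h2
    simp only [RCLike.re_to_complex] at h2
    rw [Set.mem_ofPred_eq, ContinuousLinearMap.coe_coe]
    rw [hkw] at h1 h2 ⊢
    nlinarith [mul_nonneg hlam h2]
  refine ⟨M.starProjection, isSelfAdjoint_starProjection M, M.isIdempotentElem_starProjection,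
    ?_, ?_⟩
  · rw [ContinuousLinearMap.isPositive_def']
    refine ⟨?_, fun x => ?_⟩
    · exact ((IsSelfAdjoint.all (2 : ℝ)).smul hh1.isSelfAdjoint).sub
        ((IsSelfAdjoint.one _).sub (isSelfAdjoint_starProjection M))
    obtain ⟨u, hu, v, hv, rfl⟩ : ∃ u ∈ M, ∃ v ∈ Mᗮ, x = u + v :=
      M.exists_add_mem_mem_orthogonal x
    have hhv : h v ∈ Mᗮ := by
      have : k (h v) = h (k v) := DFunLike.congr_fun hkh.eq v
      rw [hmem, this, (hmem v).1 hv, map_zero]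
    have e1 : M.starProjection u = u := M.starProjection_eq_self_iff.2 hu
    have e2 : M.starProjection v = 0 := M.starProjection_apply_eq_zero_iff.2 hv
    have c1 : inner ℂ u v = 0 := hv u hu
    have c2 : inner ℂ v u = 0 := inner_eq_zero_symm.1 c1
    have c3 : inner ℂ (h u) v = 0 := by rw [sym hs]; exact hhv u hu
    have c4 : inner ℂ (h v) u = 0 := inner_eq_zero_symm.1 (hhv u hu)
    have p1 := hh1.re_inner_nonneg_left u
    have p2 := ((ContinuousLinearMap.le_def _ _).1 hle).re_inner_nonneg_left v
    simp only [ContinuousLinearMap.reApplyInnerSelf, sub_apply,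
      smul_apply, one_apply_eq_self, e1, e2, (hmem v).1 hv, map_add,
      inner_sub_left, inner_add_left, inner_add_right, inner_zero_left, c1, c2, c3, c4,
      inner_smul_left_eq_smul, map_sub, RCLike.re_to_complex, Complex.smul_re,
      Complex.sub_re, Complex.zero_re, smul_eq_mul, map_zero] at p1 p2 ⊢
    linarith
  · rw [ContinuousLinearMap.isPositive_def']
    refine ⟨?_, fun x => ?_⟩
    · exact ((IsSelfAdjoint.all (2 * lam)).smul (isSelfAdjoint_starProjection M)).sub
        (hA.conj_starProjection M).isSelfAdjoint
    have := hM_le _ (M.starProjection_apply_mem x)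
    have e : (inner ℂ (M.starProjection x) x).re = ‖M.starProjection x‖ ^ 2 := by
      rw [← inner_self_eq_norm_sq (𝕜 := ℂ), M.inner_starProjection_left_eq_right,
        M.inner_starProjection_left_eq_right, ← mul_apply_eq_comp,
        M.isIdempotentElem_starProjection.eq]
      rfl
    simp only [ContinuousLinearMap.reApplyInnerSelf, sub_apply,
      smul_apply, ContinuousLinearMap.comp_apply, inner_sub_left,
      inner_smul_left_eq_smul, map_sub, RCLike.re_to_complex, Complex.smul_re, smul_eq_mul, e,
      M.inner_starProjection_left_eq_right (A _)]
    linarith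
end

section
/- Let n ≥ 1 and let h, A ∈ Mₙ(ℂ) be positive semidefinite matrices with h ≤ 1. Then there exists a projection e ∈ Mₙ(ℂ) such that 1 − e ≤ 2 · (1 − h) (Loewner order) and tr(e A e) ≤ 4 · tr(h A h). -/
open scoped ComplexOrder Matrix

/-- The trace of `V A V` for `V = U D Uᴴ` with `D` diagonal, in terms of the diagonal entries
of `Uᴴ A U`. -/
lemma trace_unitary_diagonal_conj {ι : Type*} [Fintype ι] [DecidableEq ι]
    {U : Matrix ι ι ℂ} (hU : Uᴴ * U = 1) (A : Matrix ι ι ℂ) (d : ι → ℂ) :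
    ((U * Matrix.diagonal d * Uᴴ) * A * (U * Matrix.diagonal d * Uᴴ)).trace
      = ∑ i, d i ^ 2 * (Uᴴ * A * U) i i := by
  have key : (U * Matrix.diagonal d * Uᴴ) * A * (U * Matrix.diagonal d * Uᴴ)
      = U * (Matrix.diagonal d * (Uᴴ * A * U) * Matrix.diagonal d * Uᴴ) := by
    simp only [Matrix.mul_assoc]
  rw [key, Matrix.trace_mul_comm, Matrix.mul_assoc, hU, Matrix.mul_one, Matrix.trace]
  refine Finset.sum_congr rfl fun i _ => ?_
  rw [Matrix.diag_apply, Matrix.mul_diagonal, Matrix.diagonal_mul]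
  ring

/-- For positive semidefinite `n × n` matrices `h ≤ 1` and `A`, there is a projection `e`
with `1 − e ≤ 2 (1 − h)` and `tr(e A e) ≤ 4 tr(h A h)`. -/
theorem stmt5 (n : ℕ) (hn : 1 ≤ n) (h A : Matrix (Fin n) (Fin n) ℂ)
    (hh : h.PosSemidef) (hA : A.PosSemidef) (hh1 : ((1 : Matrix (Fin n) (Fin n) ℂ) - h).PosSemidef) :
    ∃ e : Matrix (Fin n) (Fin n) ℂ, eᴴ = e ∧ e * e = e ∧
      ((2 : ℝ) • ((1 : Matrix (Fin n) (Fin n) ℂ) - h) - (1 - e)).PosSemidef ∧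
      (e * A * e).trace ≤ 4 * (h * A * h).trace := by
  obtain ⟨U, d, hU, hU', hd⟩ : ∃ (U : Matrix (Fin n) (Fin n) ℂ) (d : Fin n → ℝ),
      Uᴴ * U = 1 ∧ U * Uᴴ = 1 ∧ h = U * Matrix.diagonal (fun i => (d i : ℂ)) * Uᴴ :=
    ⟨hh.1.eigenvectorUnitary, hh.1.eigenvalues, Unitary.coe_star_mul_self _,
      Unitary.coe_mul_star_self _, hh.1.spectral_theorem⟩
  have hone : (1 : Matrix (Fin n) (Fin n) ℂ) = U * Matrix.diagonal (fun _ => 1) * Uᴴ := by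
    rw [Matrix.diagonal_one, Matrix.mul_one, hU']
  have hd1 : ∀ i, d i ≤ 1 := by
    have hconj : Uᴴ * (1 - h) * U = Matrix.diagonal (fun i => 1 - (d i : ℂ)) := by
      have hcancel : Uᴴ * (U * Matrix.diagonal (fun i => (d i : ℂ)) * Uᴴ) * U
          = (Uᴴ * U) * Matrix.diagonal (fun i => (d i : ℂ)) * (Uᴴ * U) := by
        simp only [Matrix.mul_assoc]
      rw [Matrix.mul_sub, Matrix.sub_mul, Matrix.mul_one, hU, hd, hcancel, hU, Matrix.one_mul,
        Matrix.mul_one, ← Matrix.diagonal_one, Matrix.diagonal_sub]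
    have hpos := hh1.conjTranspose_mul_mul_same U
    rw [hconj, Matrix.posSemidef_diagonal_iff] at hpos
    intro i
    have hi := hpos i
    rw [sub_nonneg] at hi
    exact_mod_cast hi
  let χ : Fin n → ℝ := fun i => if 1 / 2 ≤ d i then 1 else 0
  refine ⟨U * Matrix.diagonal (fun i => (χ i : ℂ)) * Uᴴ, ?_, ?_, ?_, ?_⟩
  · have hχ : star (fun i => (χ i : ℂ)) = fun i => (χ i : ℂ) := by
      ext i
      simp
    rw [Matrix.conjTranspose_mul, Matrix.conjTranspose_mul, Matrix.conjTranspose_conjTranspose,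
      Matrix.diagonal_conjTranspose, hχ, Matrix.mul_assoc]
  · have hassoc : U * Matrix.diagonal (fun i => (χ i : ℂ)) * Uᴴ *
        (U * Matrix.diagonal (fun i => (χ i : ℂ)) * Uᴴ)
        = U * (Matrix.diagonal (fun i => (χ i : ℂ)) * (Uᴴ * U) *
          Matrix.diagonal (fun i => (χ i : ℂ))) * Uᴴ := by
      simp only [Matrix.mul_assoc]
    rw [hassoc, hU, Matrix.mul_one, Matrix.diagonal_mul_diagonal]
    congr 3
    ext i
    by_cases hi : 1 / 2 ≤ d i <;> simp only [χ, hi, if_true, if_false] <;> simp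
  · have hdiag : (2 : ℝ) • ((1 : Matrix (Fin n) (Fin n) ℂ) - h)
        - (1 - U * Matrix.diagonal (fun i => (χ i : ℂ)) * Uᴴ)
        = U * Matrix.diagonal (fun i => ((2 * (1 - d i) - (1 - χ i) : ℝ) : ℂ)) * Uᴴ := by
      rw [hd, hone, ← Matrix.sub_mul, ← Matrix.mul_sub, ← Matrix.sub_mul, ← Matrix.mul_sub,
        ← Matrix.smul_mul, ← Matrix.mul_smul, ← Matrix.sub_mul, ← Matrix.mul_sub,
        Matrix.diagonal_sub, Matrix.diagonal_sub, ← Matrix.diagonal_smul, Matrix.diagonal_sub]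
      congr 3
      ext i
      simp
    rw [hdiag]
    refine Matrix.PosSemidef.mul_mul_conjTranspose_same
      (Matrix.posSemidef_diagonal_iff.mpr fun i => Complex.zero_le_real.mpr ?_) U
    have hi1 := hd1 i
    by_cases hi : 1 / 2 ≤ d i <;> simp only [χ, hi, if_true, if_false] <;> linarith
  · rw [hd, trace_unitary_diagonal_conj hU, trace_unitary_diagonal_conj hU, Finset.mul_sum]
    refine Finset.sum_le_sum fun i _ => ?_
    rw [← mul_assoc]
    refine mul_le_mul_of_nonneg_right ?_ (hA.conjTranspose_mul_mul_same U).diag_nonneg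
    have hle : χ i ^ 2 ≤ 4 * d i ^ 2 := by
      by_cases hi : 1 / 2 ≤ d i <;> simp only [χ, hi, if_true, if_false] <;> nlinarith
    exact_mod_cast hle
end

section
/- Let n ≥ 1, let ρ ∈ Mₙ(ℂ) be positive definite with tr ρ = 1, let 1 < p < ∞, and let T : Mₙ(ℂ) → Mₙ(ℂ) be a linear map such that: (1) ‖T(x)‖ ≤ ‖x‖ for all x (ℓ²-operator norm); (2) T maps positive semidefinite matrices to positive semidefinite matrices; (3) tr(ρ · T(y)) ≤ tr(ρ · y) for every positive semidefinite y. Then for every x ∈ Mₙ(ℂ): tr( ((ρ^{1/(2p)} T(x) ρ^{1/(2p)})ᴴ (ρ^{1/(2p)} T(x) ρ^{1/(2p)}))^{p/2} ) ≤ tr( ((ρ^{1/(2p)} x ρ^{1/(2p)})ᴴ (ρ^{1/(2p)} x ρ^{1/(2p)}))^{p/2} ); i.e., the Schatten p-norm of ρ^{1/(2p)} T(x) ρ^{1/(2p)} is at most that of ρ^{1/(2p)} x ρ^{1/(2p)}. (Finite-dimensional instance of the paper's L^p-contraction claim obtained from complex interpolation.) -/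
open scoped Matrix ComplexOrder

/-- The real power `A^r` of a Hermitian matrix `A`, defined spectrally:
`A^r = U · diag((λ_i)^r) · U*` where `A = U · diag(λ_i) · U*` is the spectral
decomposition of `A`. -/
noncomputable def herPow {n : ℕ} {A : Matrix (Fin n) (Fin n) ℂ}
    (hA : A.IsHermitian) (r : ℝ) : Matrix (Fin n) (Fin n) ℂ :=
  hA.eigenvectorUnitary.1 *
    Matrix.diagonal (fun i => ((hA.eigenvalues i ^ r : ℝ) : ℂ)) *
    (star hA.eigenvectorUnitary : Matrix (Fin n) (Fin n) ℂ)

/-- The ℓ²-operator norm of a complex matrix. -/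
noncomputable def l2opNorm {n : ℕ} (x : Matrix (Fin n) (Fin n) ℂ) : ℝ :=
  ‖Matrix.toEuclideanCLM (𝕜 := ℂ) x‖

lemma norm_map_vecMulVec_le {n : ℕ} (φ : Matrix (Fin n) (Fin n) ℂ →ₗ[ℂ] ℂ)
    (hφ : ∀ K : Matrix (Fin n) (Fin n) ℂ, K.PosSemidef → 0 ≤ φ K) (u v : Fin n → ℂ) :
    2 * ‖φ (Matrix.vecMulVec u (star v))‖ ≤
      (φ (Matrix.vecMulVec u (star u)) + φ (Matrix.vecMulVec v (star v))).re := by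
  set α := φ (Matrix.vecMulVec u (star v)) with hα
  set β := φ (Matrix.vecMulVec v (star u)) with hβ
  set a := φ (Matrix.vecMulVec u (star u)) with ha
  set b := φ (Matrix.vecMulVec v (star v)) with hb
  have key : ∀ c : ℂ, 0 ≤ a + star c * α + c * β + star c * c * b := by
    intro c
    have h := hφ _ (Matrix.posSemidef_vecMulVec_self_star (u + c • v))
    have e : Matrix.vecMulVec (u + c • v) (star (u + c • v)) =
        Matrix.vecMulVec u (star u) + star c • Matrix.vecMulVec u (star v) +
          c • Matrix.vecMulVec v (star u) + (star c * c) • Matrix.vecMulVec v (star v) := by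
      ext i j
      simp [Matrix.vecMulVec_apply]
      ring
    rw [e] at h
    simpa only [map_add, map_smul, smul_eq_mul] using h
  have ha0 := hφ _ (Matrix.posSemidef_vecMulVec_self_star u)
  have hb0 := hφ _ (Matrix.posSemidef_vecMulVec_self_star v)
  rw [← ha] at ha0
  rw [← hb] at hb0
  have h1 := key 1
  have h2 := key Complex.I
  have hβα : β = star α := by
    rw [Complex.nonneg_iff] at ha0 hb0 h1 h2
    have e1 := h1.2
    have e2 := h2.2
    simp at e1 e2
    apply Complex.ext
    · simp; linarith [ha0.2, hb0.2]
    · simp; linarith [ha0.2, hb0.2]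
  rcases eq_or_ne α 0 with h0 | h0
  · rw [h0, norm_zero, mul_zero]
    exact (Complex.nonneg_iff.1 (add_nonneg ha0 hb0)).1
  · have hn : (‖α‖ : ℂ) ≠ 0 := by simpa using h0
    have h3 := key (-(α / ‖α‖))
    have e : star α * α = ‖α‖ ^ 2 := by
      rw [Complex.star_def, Complex.conj_mul']
    have e3 : a + star (-(α / ‖α‖)) * α + -(α / ‖α‖) * β +
        star (-(α / ‖α‖)) * -(α / ‖α‖) * b = a + b - ((2 * ‖α‖ : ℝ) : ℂ) := by
      rw [hβα]
      have : star (-(α / (‖α‖ : ℂ))) = - (star α / ‖α‖) := by simp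
      rw [this]
      field_simp
      push_cast
      linear_combination (-2 * (‖α‖ : ℂ) + b) * e
    rw [e3] at h3
    have := (Complex.nonneg_iff.1 h3).1
    rw [Complex.sub_re, Complex.ofReal_re] at this
    linarith

lemma trace_mul_nonneg_of_posSemidef {n : ℕ} {A B : Matrix (Fin n) (Fin n) ℂ}
    (hA : A.PosSemidef) (hB : B.PosSemidef) : 0 ≤ (A * B).trace := by
  obtain ⟨X, rfl⟩ : ∃ X : Matrix (Fin n) (Fin n) ℂ, B = Xᴴ * X := by
    open scoped MatrixOrder Matrix.Norms.L2Operator in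
    exact (CStarAlgebra.nonneg_iff_eq_star_mul_self).1 hB.nonneg
  rw [← Matrix.mul_assoc, Matrix.trace_mul_comm, ← Matrix.mul_assoc]
  exact (hA.mul_mul_conjTranspose_same X).trace_nonneg

lemma trace_herPow {n : ℕ} {A : Matrix (Fin n) (Fin n) ℂ} (hA : A.IsHermitian) (r : ℝ) :
    (herPow hA r).trace = ((∑ i, hA.eigenvalues i ^ r : ℝ) : ℂ) := by
  rw [herPow, Matrix.trace_mul_comm, ← Matrix.mul_assoc,
    (Unitary.mem_iff.1 hA.eigenvectorUnitary.2).1, one_mul, Matrix.trace_diagonal]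
  push_cast
  rfl

lemma exists_unitary_mul_diagonal {n : ℕ} (N : Matrix (Fin n) (Fin n) ℂ) (s : Fin n → ℝ)
    (h : Nᴴ * N = Matrix.diagonal (fun i => ((s i ^ 2 : ℝ) : ℂ))) :
    ∃ U ∈ unitary (Matrix (Fin n) (Fin n) ℂ), N = U * Matrix.diagonal (fun i => (s i : ℂ)) := by
  have hN : ∀ i j, ∑ k, star (N k i) * N k j = if i = j then ((s i ^ 2 : ℝ) : ℂ) else 0 := by
    intro i j
    have := congrFun (congrFun h i) j
    simpa only [Matrix.mul_apply, Matrix.conjTranspose_apply, Matrix.diagonal_apply] using this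
  let v : Fin n → EuclideanSpace ℂ (Fin n) := fun i => WithLp.toLp 2 fun k => N k i / s i
  have hv : Orthonormal ℂ (({i | s i ≠ 0} : Set (Fin n)).domRestrict v) := by
    rw [orthonormal_iff_ite]
    rintro ⟨i, hi⟩ ⟨j, hj⟩
    have hi' : (s i : ℂ) ≠ 0 := by simpa using hi
    have hj' : (s j : ℂ) ≠ 0 := by simpa using hj
    have : inner ℂ (v i) (v j) = (∑ k, star (N k i) * N k j) / (s i * s j) := by
      simp only [v, PiLp.inner_apply, Finset.sum_div]
      refine Finset.sum_congr rfl fun k _ => ?_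
      simp
      field_simp
    simp only [Set.domRestrict_apply, Subtype.mk.injEq]
    rw [this, hN]
    split_ifs with hij
    · subst hij
      push_cast
      field_simp
    · simp
  obtain ⟨b, hb⟩ := hv.exists_orthonormalBasis_extension_of_card_eq (by simp)
  refine ⟨Matrix.of fun k i => b i k, ?_, ?_⟩
  · refine Matrix.mem_unitaryGroup_iff'.2 ?_
    ext i j
    have := orthonormal_iff_ite.1 b.orthonormal i j
    rw [PiLp.inner_apply] at this
    simp only [Matrix.mul_apply, Matrix.star_apply, Matrix.of_apply, Matrix.one_apply, ← this]
    refine Finset.sum_congr rfl fun k _ => ?_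
    simp [mul_comm]
  · ext k i
    rw [Matrix.mul_diagonal, Matrix.of_apply]
    by_cases hi : s i = 0
    · have h0 := hN i i
      rw [if_pos rfl, hi] at h0
      have h1 : ∑ k, ‖N k i‖ ^ 2 = 0 := by
        have : ((∑ k, ‖N k i‖ ^ 2 : ℝ) : ℂ) = 0 := by
          push_cast
          simpa [Complex.conj_mul'] using h0
        exact_mod_cast this
      have h2 := (Finset.sum_eq_zero_iff_of_nonneg (fun _ _ => by positivity)).1 h1 k
        (Finset.mem_univ k)
      simpa [hi] using h2
    · have hi' : (s i : ℂ) ≠ 0 := by simpa using hi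
      rw [hb i hi]
      simp only [v]
      field_simp

lemma exists_svd {n : ℕ} (C : Matrix (Fin n) (Fin n) ℂ) :
    ∃ U ∈ unitary (Matrix (Fin n) (Fin n) ℂ), ∃ V ∈ unitary (Matrix (Fin n) (Fin n) ℂ),
      ∃ s : Fin n → ℝ, (∀ i, 0 ≤ s i) ∧
      C = U * Matrix.diagonal (fun i => (s i : ℂ)) * Vᴴ ∧
      ∀ p : ℝ, (herPow (Matrix.posSemidef_conjTranspose_mul_self C).1 (p / 2)).trace =
        ((∑ i, s i ^ p : ℝ) : ℂ) := by
  have hps := Matrix.posSemidef_conjTranspose_mul_self C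
  set V := hps.1.eigenvectorUnitary
  have hV := Unitary.mem_iff.1 V.2
  have hsp : Cᴴ * C = V.1 * Matrix.diagonal (fun i => (hps.1.eigenvalues i : ℂ)) * star V.1 := by
    conv_lhs => rw [hps.1.spectral_theorem, Unitary.conjStarAlgAut_apply]
    rfl
  have hCV : Cᴴ * C * V.1 =
      V.1 * Matrix.diagonal (fun i => (hps.1.eigenvalues i : ℂ)) := by
    refine (congrArg (· * V.1) hsp).trans ?_
    rw [mul_assoc, hV.1, mul_one]
  obtain ⟨U, hU, hUV⟩ := exists_unitary_mul_diagonal (C * V.1)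
    (fun i => √(hps.1.eigenvalues i)) (by
      simp only [Real.sq_sqrt (hps.eigenvalues_nonneg _)]
      rw [Matrix.conjTranspose_mul, Matrix.mul_assoc, ← Matrix.mul_assoc Cᴴ, hCV,
        ← Matrix.star_eq_conjTranspose, ← mul_assoc, hV.1, one_mul])
  refine ⟨U, hU, V.1, V.2, fun i => √(hps.1.eigenvalues i), fun i => Real.sqrt_nonneg _, ?_, ?_⟩
  · rw [← hUV, Matrix.mul_assoc, ← Matrix.star_eq_conjTranspose, hV.2, mul_one]
  · intro p
    rw [trace_herPow]
    congr 1
    refine Finset.sum_congr rfl fun i _ => ?_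
    beta_reduce
    rw [Real.sqrt_eq_rpow, ← Real.rpow_mul (hps.eigenvalues_nonneg i)]
    congr 1
    ring

section

open scoped Matrix.Norms.L2Operator

lemma exists_sum_posSemidef_of_unitary {n : ℕ} {D : Matrix (Fin n) (Fin n) ℂ}
    (hD : D ∈ unitary (Matrix (Fin n) (Fin n) ℂ)) :
    ∃ (s : Finset ℂ) (P : ℂ → Matrix (Fin n) (Fin n) ℂ),
      (∀ c ∈ s, ‖c‖ = 1) ∧ (∀ c, (P c).PosSemidef) ∧ ∑ c ∈ s, P c = 1 ∧
      ∑ c ∈ s, c • P c = D := by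
  have hn : IsStarNormal D := ⟨by
    rw [Commute, SemiconjBy, (Unitary.mem_iff.1 hD).1, (Unitary.mem_iff.1 hD).2]⟩
  have hfin : (spectrum ℂ D).Finite := Matrix.finite_spectrum D
  have hc : ∀ f : ℂ → ℂ, ContinuousOn f (spectrum ℂ D) := fun f => hfin.continuousOn f
  refine ⟨hfin.toFinset, fun c => cfc (fun z => if z = c then (1 : ℂ) else 0) D, ?_, ?_, ?_, ?_⟩
  · intro c hcs
    simpa using spectrum.subset_circle_of_unitary hD (hfin.mem_toFinset.1 hcs)
  · intro c
    beta_reduce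
    have : cfc (fun z => if z = c then (1 : ℂ) else 0) D =
      (cfc (fun z => if z = c then (1 : ℂ) else 0) D)ᴴ *
        cfc (fun z => if z = c then (1 : ℂ) else 0) D := by
      rw [← Matrix.star_eq_conjTranspose, ← cfc_star, ← cfc_mul _ _ D (hc _) (hc _)]
      congr 1
      ext z
      split_ifs <;> simp
    rw [this]
    exact Matrix.posSemidef_conjTranspose_mul_self _
  · rw [← cfc_sum _ _ _ (fun i _ => hc _), ← cfc_one ℂ D]
    refine cfc_congr fun z hz => ?_
    simp [Finset.sum_apply, hz]
  · simp_rw [← cfc_smul _ _ D (hc _)]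
    rw [← cfc_sum _ _ _ (fun i _ => hc _)]
    conv_rhs => rw [← cfc_id ℂ D]
    refine cfc_congr fun z hz => ?_
    simp [Finset.sum_apply, hz]

lemma norm_trace_map_vecMulVec_mul_le {n : ℕ}
    (S : Matrix (Fin n) (Fin n) ℂ →ₗ[ℂ] Matrix (Fin n) (Fin n) ℂ)
    (hS : ∀ y : Matrix (Fin n) (Fin n) ℂ, y.PosSemidef → (S y).PosSemidef)
    (hStr : ∀ y : Matrix (Fin n) (Fin n) ℂ, y.PosSemidef → (S y).trace ≤ y.trace)
    {D : Matrix (Fin n) (Fin n) ℂ} (hD : D ∈ unitary (Matrix (Fin n) (Fin n) ℂ))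
    (u v : Fin n → ℂ) (hu : u ⬝ᵥ star u = 1) (hv : v ⬝ᵥ star v = 1) :
    ‖(S (Matrix.vecMulVec u (star v)) * D).trace‖ ≤ 1 := by
  obtain ⟨s, P, hs, hP, hP1, hPD⟩ := exists_sum_posSemidef_of_unitary hD
  let φ : ℂ → Matrix (Fin n) (Fin n) ℂ →ₗ[ℂ] ℂ := fun c =>
    Matrix.traceLinearMap (Fin n) ℂ ℂ ∘ₗ LinearMap.mulRight ℂ (P c) ∘ₗ S
  have hφ : ∀ c K, φ c K = (S K * P c).trace := fun c K => rfl
  have hsum : ∀ K, ∑ c ∈ s, φ c K = (S K).trace := by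
    intro K
    simp_rw [hφ]
    rw [← Matrix.trace_sum, ← Finset.mul_sum, hP1, mul_one]
  have hb : ∀ w : Fin n → ℂ, w ⬝ᵥ star w = 1 →
      (∑ c ∈ s, φ c (Matrix.vecMulVec w (star w))).re ≤ 1 := by
    intro w hw
    have h := hStr _ (Matrix.posSemidef_vecMulVec_self_star w)
    rw [Matrix.trace_vecMulVec, hw] at h
    rw [hsum]
    simpa using (Complex.le_def.1 h).1
  calc ‖(S (Matrix.vecMulVec u (star v)) * D).trace‖
      = ‖∑ c ∈ s, c * φ c (Matrix.vecMulVec u (star v))‖ := by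
        simp_rw [hφ]
        rw [← hPD, Finset.mul_sum, Matrix.trace_sum]
        simp
    _ ≤ ∑ c ∈ s, ‖φ c (Matrix.vecMulVec u (star v))‖ := by
        refine (norm_sum_le _ _).trans (Finset.sum_le_sum fun c hc => ?_)
        rw [norm_mul, hs c hc, one_mul]
    _ ≤ ∑ c ∈ s, (φ c (Matrix.vecMulVec u (star u)) +
          φ c (Matrix.vecMulVec v (star v))).re / 2 := by
        refine Finset.sum_le_sum fun c _ => ?_
        have := norm_map_vecMulVec_le (φ c)
          (fun K hK => trace_mul_nonneg_of_posSemidef (hS K hK) (hP c)) u v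
        linarith
    _ = ((∑ c ∈ s, φ c (Matrix.vecMulVec u (star u))).re +
          (∑ c ∈ s, φ c (Matrix.vecMulVec v (star v))).re) / 2 := by
        rw [← Finset.sum_div, ← Complex.re_sum, Finset.sum_add_distrib, Complex.add_re]
    _ ≤ 1 := by linarith [hb u hu, hb v hv]

lemma mul_diagonal_mul_conjTranspose_eq_sum {n : ℕ} (U V : Matrix (Fin n) (Fin n) ℂ)
    (a : Fin n → ℂ) :
    U * Matrix.diagonal a * Vᴴ =
      ∑ i, a i • Matrix.vecMulVec (fun k => U k i) (star fun k => V k i) := by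
  ext k l
  simp only [Matrix.mul_apply (M := U * Matrix.diagonal a), Matrix.mul_diagonal, Matrix.sum_apply,
    Matrix.smul_apply, Matrix.vecMulVec_apply, Matrix.conjTranspose_apply, Pi.star_apply,
    smul_eq_mul]
  exact Finset.sum_congr rfl fun i _ => by ring

lemma dotProduct_star_col_of_unitary {n : ℕ} {U : Matrix (Fin n) (Fin n) ℂ}
    (hU : U ∈ unitary (Matrix (Fin n) (Fin n) ℂ)) (i : Fin n) :
    (fun k => U k i) ⬝ᵥ star (fun k => U k i) = 1 := by
  have := congrFun (congrFun (Unitary.mem_iff.1 hU).1 i) i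
  rw [Matrix.one_apply_eq, Matrix.mul_apply] at this
  rw [← this]
  exact Finset.sum_congr rfl fun k _ => by simp [mul_comm]

lemma norm_trace_map_mul_le_of_unitary {n : ℕ}
    (S : Matrix (Fin n) (Fin n) ℂ →ₗ[ℂ] Matrix (Fin n) (Fin n) ℂ)
    (hS : ∀ y : Matrix (Fin n) (Fin n) ℂ, y.PosSemidef → (S y).PosSemidef)
    (hStr : ∀ y : Matrix (Fin n) (Fin n) ℂ, y.PosSemidef → (S y).trace ≤ y.trace)
    {D U V : Matrix (Fin n) (Fin n) ℂ} (hD : D ∈ unitary (Matrix (Fin n) (Fin n) ℂ))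
    (hU : U ∈ unitary (Matrix (Fin n) (Fin n) ℂ)) (hV : V ∈ unitary (Matrix (Fin n) (Fin n) ℂ))
    (a : Fin n → ℂ) :
    ‖(S (U * Matrix.diagonal a * Vᴴ) * D).trace‖ ≤ ∑ i, ‖a i‖ := by
  rw [mul_diagonal_mul_conjTranspose_eq_sum, map_sum, Finset.sum_mul, Matrix.trace_sum]
  refine (norm_sum_le _ _).trans (Finset.sum_le_sum fun i _ => ?_)
  rw [map_smul, Matrix.smul_mul, Matrix.trace_smul, norm_smul]
  exact mul_le_of_le_one_right (norm_nonneg _) (norm_trace_map_vecMulVec_mul_le S hS hStr hD _ _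
    (dotProduct_star_col_of_unitary hU i) (dotProduct_star_col_of_unitary hV i))

lemma diagonal_mem_unitary {n : ℕ} {b : Fin n → ℂ} (hb : ∀ i, ‖b i‖ = 1) :
    Matrix.diagonal b ∈ unitary (Matrix (Fin n) (Fin n) ℂ) := by
  refine Matrix.mem_unitaryGroup_iff.2 ?_
  rw [Matrix.star_eq_conjTranspose, Matrix.diagonal_conjTranspose, Matrix.diagonal_mul_diagonal,
    ← Matrix.diagonal_one]
  congr 1
  ext i
  simp [Complex.mul_conj', hb]

lemma norm_trace_map_mul_le {n : ℕ}
    (S : Matrix (Fin n) (Fin n) ℂ →ₗ[ℂ] Matrix (Fin n) (Fin n) ℂ)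
    (hS : ∀ y : Matrix (Fin n) (Fin n) ℂ, y.PosSemidef → (S y).PosSemidef)
    (hStr : ∀ y : Matrix (Fin n) (Fin n) ℂ, y.PosSemidef → (S y).trace ≤ y.trace)
    {X Y U V : Matrix (Fin n) (Fin n) ℂ} (hX : X ∈ unitary (Matrix (Fin n) (Fin n) ℂ))
    (hY : Y ∈ unitary (Matrix (Fin n) (Fin n) ℂ))
    (hU : U ∈ unitary (Matrix (Fin n) (Fin n) ℂ)) (hV : V ∈ unitary (Matrix (Fin n) (Fin n) ℂ))
    (a b : Fin n → ℂ) (hb : ∀ i, b i = 0 ∨ ‖b i‖ = 1) :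
    ‖(S (U * Matrix.diagonal a * Vᴴ) * (X * Matrix.diagonal b * Y)).trace‖ ≤ ∑ i, ‖a i‖ := by
  let c : ℂ → Fin n → ℂ := fun e i => if b i = 0 then e else b i
  have hc : ∀ e : ℂ, ‖e‖ = 1 →
      ‖(S (U * Matrix.diagonal a * Vᴴ) * (X * Matrix.diagonal (c e) * Y)).trace‖ ≤
        ∑ i, ‖a i‖ := by
    intro e he
    refine norm_trace_map_mul_le_of_unitary S hS hStr
      (mul_mem (mul_mem hX (diagonal_mem_unitary fun i => ?_)) hY) hU hV a
    by_cases hi : b i = 0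
    · simp [c, hi, he]
    · simpa [c, hi] using (hb i).resolve_left hi
  have hbc : Matrix.diagonal b =
      (1 / 2 : ℂ) • (Matrix.diagonal (c 1) + Matrix.diagonal (c (-1))) := by
    rw [Matrix.diagonal_add, ← Matrix.diagonal_smul]
    congr 1
    ext i
    by_cases hi : b i = 0
    · simp [c, hi]
    · simp [c, hi]
      ring
  have h1 := hc 1 (by simp)
  have h2 := hc (-1) (by simp)
  rw [hbc, Matrix.mul_smul, Matrix.smul_mul, Matrix.mul_smul, Matrix.trace_smul, mul_add, add_mul,
    mul_add, Matrix.trace_add, norm_smul]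
  have h3 := norm_add_le
    (S (U * Matrix.diagonal a * Vᴴ) * (X * Matrix.diagonal (c 1) * Y)).trace
    (S (U * Matrix.diagonal a * Vᴴ) * (X * Matrix.diagonal (c (-1)) * Y)).trace
  norm_num
  linarith

lemma norm_apply_le_l2_opNorm {n : ℕ} (M : Matrix (Fin n) (Fin n) ℂ) (i j : Fin n) :
    ‖M i j‖ ≤ ‖M‖ := by
  have h := Matrix.l2_opNorm_mulVec M (EuclideanSpace.single j (1 : ℂ))
  rw [PiLp.norm_single, norm_one, mul_one] at h
  refine le_trans ?_ h
  refine le_trans (le_of_eq ?_) (PiLp.norm_apply_le _ i)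
  simp

lemma norm_le_one_of_mem_unitary {n : ℕ} {U : Matrix (Fin n) (Fin n) ℂ}
    (hU : U ∈ unitary (Matrix (Fin n) (Fin n) ℂ)) : ‖U‖ ≤ 1 := by
  rcases subsingleton_or_nontrivial (Matrix (Fin n) (Fin n) ℂ) with h | h
  · rw [Subsingleton.elim U 0, norm_zero]
    exact zero_le_one
  · exact (CStarRing.norm_of_mem_unitary hU).le

lemma norm_unitary_mul_mul_unitary_le {n : ℕ} {U V : Matrix (Fin n) (Fin n) ℂ}
    (hU : U ∈ unitary (Matrix (Fin n) (Fin n) ℂ)) (hV : V ∈ unitary (Matrix (Fin n) (Fin n) ℂ))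
    (M : Matrix (Fin n) (Fin n) ℂ) : ‖U * M * V‖ ≤ ‖M‖ := by
  calc ‖U * M * V‖ ≤ ‖U * M‖ * ‖V‖ := norm_mul_le _ _
    _ ≤ (‖U‖ * ‖M‖) * ‖V‖ := by gcongr; exact norm_mul_le _ _
    _ ≤ (1 * ‖M‖) * 1 := by gcongr <;> exact norm_le_one_of_mem_unitary ‹_›
    _ = ‖M‖ := by ring

lemma norm_trace_mul_le {n : ℕ} {X Y : Matrix (Fin n) (Fin n) ℂ}
    (hX : X ∈ unitary (Matrix (Fin n) (Fin n) ℂ)) (hY : Y ∈ unitary (Matrix (Fin n) (Fin n) ℂ))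
    (M : Matrix (Fin n) (Fin n) ℂ) (b : Fin n → ℂ) :
    ‖(M * (X * Matrix.diagonal b * Y)).trace‖ ≤ ‖M‖ * ∑ i, ‖b i‖ := by
  have : (M * (X * Matrix.diagonal b * Y)).trace = ∑ i, (Y * M * X) i i * b i := by
    rw [← mul_assoc, Matrix.trace_mul_comm, ← mul_assoc, ← mul_assoc, Matrix.trace]
    simp [Matrix.mul_diagonal]
  rw [this, Finset.mul_sum]
  refine (norm_sum_le _ _).trans (Finset.sum_le_sum fun i _ => ?_)
  rw [norm_mul]
  gcongr
  exact (norm_apply_le_l2_opNorm _ i i).trans (norm_unitary_mul_mul_unitary_le hY hX M)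

/-- The power `s ^ w`, with the convention `0 ^ w = 0` for every exponent, so that it is entire
in `w` for every fixed base `s ≥ 0`. -/
noncomputable def entirePow (s : ℝ) (w : ℂ) : ℂ :=
  if s = 0 then 0 else Complex.exp (w * Real.log s)

lemma entirePow_add (s : ℝ) (w w' : ℂ) :
    entirePow s (w + w') = entirePow s w * entirePow s w' := by
  unfold entirePow
  split_ifs
  · simp
  · rw [add_mul, Complex.exp_add]

lemma entirePow_zero {s : ℝ} (hs : s ≠ 0) : entirePow s 0 = 1 := by
  simp [entirePow, hs]

lemma entirePow_ofReal {s : ℝ} (hs : 0 ≤ s) {x : ℝ} (hx : x ≠ 0) :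
    entirePow s x = ((s ^ x : ℝ) : ℂ) := by
  unfold entirePow
  split_ifs with h
  · simp [h, Real.zero_rpow hx]
  · rw [Real.rpow_def_of_pos (lt_of_le_of_ne hs (Ne.symm h)), mul_comm]
    push_cast
    rfl

lemma norm_entirePow {s : ℝ} (hs : s ≠ 0) (w : ℂ) :
    ‖entirePow s w‖ = Real.exp (w.re * Real.log s) := by
  rw [entirePow, if_neg hs, Complex.norm_exp, Complex.re_mul_ofReal]

lemma norm_entirePow_of_re_eq_zero {s : ℝ} (hs : s ≠ 0) {w : ℂ} (hw : w.re = 0) :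
    ‖entirePow s w‖ = 1 := by
  rw [norm_entirePow hs, hw, zero_mul, Real.exp_zero]

lemma norm_entirePow_eq_rpow {s : ℝ} (hs : 0 ≤ s) {w : ℂ} (hw : w.re ≠ 0) :
    ‖entirePow s w‖ = s ^ w.re := by
  rcases eq_or_ne s 0 with h | h
  · simp [entirePow, h, Real.zero_rpow hw]
  · rw [norm_entirePow h, Real.rpow_def_of_pos (lt_of_le_of_ne hs (Ne.symm h)), mul_comm]

/-- Entire functions that are bounded on the strip `0 ≤ Re z ≤ 1`. -/
def BoundedEntire {E : Type*} [NormedAddCommGroup E] [NormedSpace ℂ E] (f : ℂ → E) : Prop :=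
  Differentiable ℂ f ∧ ∃ C, ∀ z : ℂ, 0 ≤ z.re → z.re ≤ 1 → ‖f z‖ ≤ C

namespace BoundedEntire

variable {E F : Type*} [NormedAddCommGroup E] [NormedSpace ℂ E] [NormedAddCommGroup F]
  [NormedSpace ℂ F]

lemma const (c : E) : BoundedEntire fun _ : ℂ => c :=
  ⟨differentiable_const c, ‖c‖, fun _ _ _ => le_rfl⟩

lemma clm_comp {f : ℂ → E} (hf : BoundedEntire f) (L : E →L[ℂ] F) :
    BoundedEntire fun z => L (f z) := by
  obtain ⟨hd, C, hC⟩ := hf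
  refine ⟨L.differentiable.comp hd, ‖L‖ * C, fun z h0 h1 => ?_⟩
  exact (L.le_opNorm _).trans (mul_le_mul_of_nonneg_left (hC z h0 h1) (norm_nonneg _))

lemma linearMap_comp [FiniteDimensional ℂ E] {f : ℂ → E} (hf : BoundedEntire f) (L : E →ₗ[ℂ] F) :
    BoundedEntire fun z => L (f z) :=
  hf.clm_comp (LinearMap.toContinuousLinearMap L)

lemma mul {A : Type*} [NormedRing A] [NormedAlgebra ℂ A] {f g : ℂ → A} (hf : BoundedEntire f)
    (hg : BoundedEntire g) : BoundedEntire fun z => f z * g z := by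
  obtain ⟨hd, C, hC⟩ := hf
  obtain ⟨hd', C', hC'⟩ := hg
  refine ⟨hd.mul hd', C * C', fun z h0 h1 => (norm_mul_le _ _).trans ?_⟩
  exact mul_le_mul (hC z h0 h1) (hC' z h0 h1) (norm_nonneg _)
    ((norm_nonneg _).trans (hC z h0 h1))

lemma pi {ι : Type*} [Fintype ι] {f : ℂ → ι → E} (hf : ∀ i, BoundedEntire fun z => f z i) :
    BoundedEntire f := by
  choose hd C hC using hf
  refine ⟨differentiable_pi.2 hd, ∑ i, |C i|, fun z h0 h1 => ?_⟩
  rw [pi_norm_le_iff_of_nonneg (Finset.sum_nonneg fun i _ => abs_nonneg _)]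
  intro i
  exact ((hC i z h0 h1).trans (le_abs_self _)).trans
    (Finset.single_le_sum (f := fun i => |C i|) (fun i _ => abs_nonneg _) (Finset.mem_univ i))

lemma entirePow_affine (s a b : ℝ) :
    BoundedEntire fun z : ℂ => entirePow s (a + b * z) := by
  rcases eq_or_ne s 0 with h | h
  · simpa [entirePow, h] using const (0 : ℂ)
  · refine ⟨?_, Real.exp ((|a| + |b|) * |Real.log s|), fun z h0 h1 => ?_⟩
    · simp only [entirePow, if_neg h]
      fun_prop
    · rw [norm_entirePow h, Real.exp_le_exp]
      refine (le_abs_self _).trans ?_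
      rw [abs_mul]
      refine mul_le_mul_of_nonneg_right ?_ (abs_nonneg _)
      simp only [Complex.add_re, Complex.ofReal_re, Complex.re_ofReal_mul]
      refine (abs_add_le _ _).trans (add_le_add_right ?_ _)
      rw [abs_mul, abs_of_nonneg h0]
      exact mul_le_of_le_one_right (abs_nonneg _) h1

lemma diagonal_entirePow {n : ℕ} (s : Fin n → ℝ) (a b : ℝ) :
    BoundedEntire fun z : ℂ => Matrix.diagonal fun i => entirePow (s i) (a + b * z) :=
  (pi (f := fun (z : ℂ) (i : Fin n) => entirePow (s i) (a + b * z))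
    fun i => entirePow_affine (s i) a b).linearMap_comp (Matrix.diagonalLinearMap (Fin n) ℂ ℂ)

lemma norm_le_interp {f : ℂ → E} (hf : BoundedEntire f) {a b t : ℝ} (ht0 : 0 ≤ t) (ht1 : t ≤ 1)
    (ha : ∀ z : ℂ, z.re = 0 → ‖f z‖ ≤ a) (hb : ∀ z : ℂ, z.re = 1 → ‖f z‖ ≤ b) :
    ‖f t‖ ≤ a ^ (1 - t) * b ^ t := by
  obtain ⟨hd, C, hC⟩ := hf
  have := Complex.HadamardThreeLines.norm_le_interp_of_mem_verticalClosedStrip₀₁' f (z := t)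
    (a := a) (b := b) (by simp [Complex.HadamardThreeLines.verticalClosedStrip, ht0, ht1])
    hd.diffContOnCl
    ⟨C, by rintro _ ⟨z, hz, rfl⟩; exact hC z hz.1 hz.2⟩
    (fun z hz => ha z (by simpa using hz)) (fun z hz => hb z (by simpa using hz))
  simpa using this

end BoundedEntire

/-- The complex power `W · diag(r_i ^ z) · W*` of the matrix `W · diag(r_i) · W*`. -/
noncomputable def conjPow {n : ℕ} (W : Matrix (Fin n) (Fin n) ℂ) (r : Fin n → ℝ) (z : ℂ) :
    Matrix (Fin n) (Fin n) ℂ :=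
  W * Matrix.diagonal (fun i => entirePow (r i) z) * Wᴴ

section conjPow

variable {n : ℕ} {W : Matrix (Fin n) (Fin n) ℂ} {r : Fin n → ℝ}

lemma conjPow_add (hW : W ∈ unitary (Matrix (Fin n) (Fin n) ℂ)) (z w : ℂ) :
    conjPow W r (z + w) = conjPow W r z * conjPow W r w := by
  have h := (Unitary.mem_iff.1 hW).1
  rw [Matrix.star_eq_conjTranspose] at h
  simp only [conjPow, entirePow_add, ← Matrix.diagonal_mul_diagonal]
  simp only [mul_assoc]
  rw [← mul_assoc Wᴴ W, h, one_mul]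

lemma conjPow_zero (hW : W ∈ unitary (Matrix (Fin n) (Fin n) ℂ)) (hr : ∀ i, r i ≠ 0) :
    conjPow W r 0 = 1 := by
  have h := (Unitary.mem_iff.1 hW).2
  rw [Matrix.star_eq_conjTranspose] at h
  simp [conjPow, entirePow_zero (hr _), h]

lemma conjPow_mem_unitary (hW : W ∈ unitary (Matrix (Fin n) (Fin n) ℂ)) (hr : ∀ i, r i ≠ 0)
    {z : ℂ} (hz : z.re = 0) : conjPow W r z ∈ unitary (Matrix (Fin n) (Fin n) ℂ) :=
  mul_mem (mul_mem hW (diagonal_mem_unitary fun i => norm_entirePow_of_re_eq_zero (hr i) hz))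
    (Unitary.star_mem hW)

lemma conjPow_ofReal_conjTranspose (x : ℝ) : (conjPow W r x)ᴴ = conjPow W r x := by
  simp only [conjPow, Matrix.conjTranspose_mul, Matrix.conjTranspose_conjTranspose,
    Matrix.diagonal_conjTranspose, mul_assoc]
  congr 3
  ext i
  simp only [Pi.star_apply, entirePow]
  split_ifs
  · simp
  · rw [← Complex.ofReal_mul, ← Complex.ofReal_exp]
    exact Complex.conj_ofReal _

lemma BoundedEntire.conjPow_affine (a b : ℝ) :
    BoundedEntire fun z : ℂ => conjPow W r (a + b * z) :=
  ((BoundedEntire.const W).mul (.diagonal_entirePow r a b)).mul (.const Wᴴ)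

end conjPow

lemma sum_rpow_le_of_interpolation {n : ℕ} {W : Matrix (Fin n) (Fin n) ℂ}
    (hW : W ∈ unitary (Matrix (Fin n) (Fin n) ℂ)) {r : Fin n → ℝ} (hr : ∀ i, r i ≠ 0)
    {p : ℝ} (hp : 1 < p)
    (T : Matrix (Fin n) (Fin n) ℂ →ₗ[ℂ] Matrix (Fin n) (Fin n) ℂ)
    (hTcontr : ∀ x : Matrix (Fin n) (Fin n) ℂ, ‖T x‖ ≤ ‖x‖)
    (hTpos : ∀ y : Matrix (Fin n) (Fin n) ℂ, y.PosSemidef → (T y).PosSemidef)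
    (hTtr : ∀ y : Matrix (Fin n) (Fin n) ℂ, y.PosSemidef →
      (conjPow W r 1 * T y).trace ≤ (conjPow W r 1 * y).trace)
    {U V U' V' : Matrix (Fin n) (Fin n) ℂ}
    (hU : U ∈ unitary (Matrix (Fin n) (Fin n) ℂ)) (hV : V ∈ unitary (Matrix (Fin n) (Fin n) ℂ))
    (hU' : U' ∈ unitary (Matrix (Fin n) (Fin n) ℂ))
    (hV' : V' ∈ unitary (Matrix (Fin n) (Fin n) ℂ))
    {s s' : Fin n → ℝ} (hs : ∀ i, 0 ≤ s i) (hs' : ∀ i, 0 ≤ s' i) (x : Matrix (Fin n) (Fin n) ℂ)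
    (hx : conjPow W r ((1 / (2 * p) : ℝ) : ℂ) * x * conjPow W r ((1 / (2 * p) : ℝ) : ℂ) =
      U * Matrix.diagonal (fun i => (s i : ℂ)) * Vᴴ)
    (hTx : conjPow W r ((1 / (2 * p) : ℝ) : ℂ) * T x * conjPow W r ((1 / (2 * p) : ℝ) : ℂ) =
      U' * Matrix.diagonal (fun i => (s' i : ℂ)) * V'ᴴ) :
    ∑ i, s' i ^ p ≤ ∑ i, s i ^ p := by
  have hp0 : 0 < p := by linarith
  set R := conjPow W r with hR
  have hRadd : ∀ z w, R (z + w) = R z * R w := conjPow_add hW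
  have hR0 : R 0 = 1 := conjPow_zero hW hr
  have hRneg : ∀ z, R (-z) * R z = 1 := fun z => by rw [← hRadd, neg_add_cancel, hR0]
  have hRneg' : ∀ z, R z * R (-z) = 1 := fun z => by rw [← hRadd, add_neg_cancel, hR0]
  -- the analytic family through `x`
  let X : ℂ → Matrix (Fin n) (Fin n) ℂ := fun z =>
    R (-(z / 2)) * (U * Matrix.diagonal (fun i => entirePow (s i) (p * z)) * Vᴴ) * R (-(z / 2))
  let B : ℂ → Matrix (Fin n) (Fin n) ℂ := fun z =>
    V' * Matrix.diagonal (fun i => entirePow (s' i) (p * (1 - z))) * U'ᴴ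
  let f : ℂ → ℂ := fun z => (R (z / 2) * T (X z) * R (z / 2) * B z).trace
  have hf : BoundedEntire f := by
    have h1 : BoundedEntire fun z : ℂ => R (z / 2) := by
      simpa [div_eq_inv_mul] using BoundedEntire.conjPow_affine (W := W) (r := r) 0 (1 / 2)
    have h2 : BoundedEntire fun z : ℂ => R (-(z / 2)) := by
      simpa [div_eq_inv_mul] using BoundedEntire.conjPow_affine (W := W) (r := r) 0 (-(1 / 2))
    have h3 : BoundedEntire fun z : ℂ =>
        Matrix.diagonal (fun i => entirePow (s i) (p * z)) := by
      simpa using BoundedEntire.diagonal_entirePow s 0 p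
    have h4 : BoundedEntire fun z : ℂ =>
        Matrix.diagonal (fun i => entirePow (s' i) (p * (1 - z))) := by
      have := BoundedEntire.diagonal_entirePow s' p (-p)
      refine cast (congrArg BoundedEntire ?_) this
      ext1 z
      congr 1
      ext1 i
      congr 1
      push_cast
      ring
    have hX : BoundedEntire X := (h2.mul (((BoundedEntire.const U).mul h3).mul (.const Vᴴ))).mul h2
    have hB : BoundedEntire B := ((BoundedEntire.const V').mul h4).mul (.const U'ᴴ)
    exact (((h1.mul (hX.linearMap_comp T)).mul h1).mul hB).linearMap_comp
      (Matrix.traceLinearMap (Fin n) ℂ ℂ)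
  have hleft : ∀ z : ℂ, z.re = 0 → ‖f z‖ ≤ ∑ i, s' i ^ p := by
    intro z hz
    have hu : R (z / 2) ∈ unitary (Matrix (Fin n) (Fin n) ℂ) :=
      conjPow_mem_unitary hW hr (by simp [hz])
    have hu' : R (-(z / 2)) ∈ unitary (Matrix (Fin n) (Fin n) ℂ) :=
      conjPow_mem_unitary hW hr (by simp [hz])
    have hXz : ‖X z‖ ≤ 1 := by
      refine (norm_unitary_mul_mul_unitary_le hu' hu' _).trans
        ((norm_unitary_mul_mul_unitary_le hU (Unitary.star_mem hV) _).trans ?_)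
      rw [Matrix.l2_opNorm_diagonal, pi_norm_le_iff_of_nonneg zero_le_one]
      intro i
      rcases eq_or_ne (s i) 0 with h | h
      · simp [entirePow, h]
      · exact (norm_entirePow_of_re_eq_zero h (by simp [hz])).le
    refine (norm_trace_mul_le hV' (Unitary.star_mem hU') _ _).trans ?_
    refine (mul_le_of_le_one_left (Finset.sum_nonneg fun i _ => norm_nonneg _)
      ((norm_unitary_mul_mul_unitary_le hu hu _).trans ((hTcontr _).trans hXz))).trans ?_
    refine (Finset.sum_congr rfl fun i _ => ?_).le
    have hre : ((p : ℂ) * (1 - z)).re = p := by simp [hz]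
    rw [norm_entirePow_eq_rpow (hs' i) (by rw [hre]; exact hp0.ne'), hre]
  have hright : ∀ z : ℂ, z.re = 1 → ‖f z‖ ≤ ∑ i, s i ^ p := by
    intro z hz
    let H := R ((1 / 2 : ℝ) : ℂ)
    let K := R (-((1 / 2 : ℝ) : ℂ))
    have hH : Hᴴ = H := conjPow_ofReal_conjTranspose _
    have hK : Kᴴ = K := by
      have := conjPow_ofReal_conjTranspose (W := W) (r := r) (-(1 / 2))
      simpa [K, hR] using this
    have hHH : H * H = R 1 := by
      rw [← hRadd]
      congr 1
      push_cast
      norm_num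
    let S : Matrix (Fin n) (Fin n) ℂ →ₗ[ℂ] Matrix (Fin n) (Fin n) ℂ :=
      (LinearMap.mulRight ℂ H ∘ₗ LinearMap.mulLeft ℂ H) ∘ₗ T ∘ₗ
        LinearMap.mulRight ℂ K ∘ₗ LinearMap.mulLeft ℂ K
    have hSdef : ∀ y, S y = H * T (K * y * K) * H := fun y => rfl
    have hKpos : ∀ y : Matrix (Fin n) (Fin n) ℂ, y.PosSemidef → (K * y * K).PosSemidef :=
      fun y hy => by simpa only [hK] using hy.mul_mul_conjTranspose_same K
    have hS : ∀ y : Matrix (Fin n) (Fin n) ℂ, y.PosSemidef → (S y).PosSemidef := fun y hy => by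
      simpa only [hH, hSdef] using (hTpos _ (hKpos y hy)).mul_mul_conjTranspose_same H
    have hStr : ∀ y : Matrix (Fin n) (Fin n) ℂ, y.PosSemidef → (S y).trace ≤ y.trace := by
      intro y hy
      have h := hTtr _ (hKpos y hy)
      rw [← hHH] at h
      have e : (H * H * (K * y * K)).trace = y.trace := by
        have e1 : H * H * (K * y * K) = H * ((H * K) * y * K) := by simp only [mul_assoc]
        rw [e1, hRneg', one_mul, Matrix.trace_mul_comm, mul_assoc, hRneg, mul_one]
      rw [e, mul_assoc, Matrix.trace_mul_comm] at h
      exact h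
    let w : ℂ := (z - 1) / 2
    have hw : w.re = 0 := by simp [w, hz]
    have hw' : (-w).re = 0 := by simp [hw]
    have e1 : R (z / 2) = R w * H := by
      rw [← hRadd]; congr 1; push_cast; ring
    have e1' : R (z / 2) = H * R w := by
      rw [← hRadd]; congr 1; push_cast; ring
    have e2 : R (-(z / 2)) = R (-w) * K := by
      rw [← hRadd]; congr 1; push_cast; ring
    have e2' : R (-(z / 2)) = K * R (-w) := by
      rw [← hRadd]; congr 1; push_cast; ring
    have hu := conjPow_mem_unitary hW hr hw
    have hu' := conjPow_mem_unitary hW hr hw'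
    have hXz : X z = K * ((R (-w) * U) * Matrix.diagonal (fun i => entirePow (s i) (p * z)) *
        ((R (-w))ᴴ * V)ᴴ) * K := by
      simp only [X]
      nth_rewrite 1 [e2']
      rw [e2]
      simp only [Matrix.conjTranspose_mul, Matrix.conjTranspose_conjTranspose, mul_assoc]
    have hfz : f z = (S ((R (-w) * U) * Matrix.diagonal (fun i => entirePow (s i) (p * z)) *
        ((R (-w))ᴴ * V)ᴴ) *
        ((R w * V') * Matrix.diagonal (fun i => entirePow (s' i) (p * (1 - z))) *
          (U'ᴴ * R w))).trace := by
      rw [hSdef, ← hXz]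
      simp only [f, B]
      nth_rewrite 1 [e1]
      rw [e1']
      rw [show R w * H * T (X z) * (H * R w) *
          (V' * Matrix.diagonal (fun i => entirePow (s' i) (p * (1 - z))) * U'ᴴ) =
          R w * (H * T (X z) * H * (R w * V' *
            Matrix.diagonal (fun i => entirePow (s' i) (p * (1 - z))) * U'ᴴ)) by
        simp only [mul_assoc], Matrix.trace_mul_comm]
      simp only [mul_assoc]
    rw [hfz]
    refine (norm_trace_map_mul_le S hS hStr (mul_mem hu hV') (mul_mem (Unitary.star_mem hU') hu)
      (mul_mem hu' hU) (mul_mem (Unitary.star_mem hu') hV) _ _ fun i => ?_).trans ?_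
    · rcases eq_or_ne (s' i) 0 with h | h
      · exact Or.inl (by simp [entirePow, h])
      · exact Or.inr (norm_entirePow_of_re_eq_zero h (by simp [hz]))
    · refine (Finset.sum_congr rfl fun i _ => ?_).le
      have hre : ((p : ℂ) * z).re = p := by simp [hz]
      rw [norm_entirePow_eq_rpow (hs i) (by rw [hre]; exact hp0.ne'), hre]
  have hpc : (p : ℂ) ≠ 0 := by exact_mod_cast hp0.ne'
  have hval : f ((1 / p : ℝ) : ℂ) = ((∑ i, s' i ^ p : ℝ) : ℂ) := by
    have e0 : (((1 / p : ℝ) : ℂ) / 2) = ((1 / (2 * p) : ℝ) : ℂ) := by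
      push_cast
      field_simp
    have e1 : (p : ℂ) * ((1 / p : ℝ) : ℂ) = ((1 : ℝ) : ℂ) := by
      push_cast
      field_simp
    have e2 : (p : ℂ) * (1 - ((1 / p : ℝ) : ℂ)) = ((p - 1 : ℝ) : ℂ) := by
      rw [mul_sub, e1]
      push_cast
      ring
    have hXx : X ((1 / p : ℝ) : ℂ) = x := by
      simp only [X, e0, e1, entirePow_ofReal (hs _) one_ne_zero, Real.rpow_one]
      rw [← hx]
      simp only [← mul_assoc, hRneg, one_mul]
      rw [mul_assoc, hRneg', mul_one]
    have hV1 := (Unitary.mem_iff.1 hV').1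
    have hU1 := (Unitary.mem_iff.1 hU').1
    rw [Matrix.star_eq_conjTranspose] at hV1 hU1
    simp only [f, B, hXx, e0, e2, hTx,
      entirePow_ofReal (hs' _) (sub_pos.2 hp).ne']
    rw [show U' * Matrix.diagonal (fun i => (s' i : ℂ)) * V'ᴴ *
        (V' * Matrix.diagonal (fun i => ((s' i ^ (p - 1) : ℝ) : ℂ)) * U'ᴴ) =
        U' * (Matrix.diagonal (fun i => (s' i : ℂ)) * ((V'ᴴ * V') *
          Matrix.diagonal (fun i => ((s' i ^ (p - 1) : ℝ) : ℂ))) * U'ᴴ) by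
      simp only [mul_assoc], hV1, one_mul, Matrix.trace_mul_comm, mul_assoc, hU1, mul_one,
      Matrix.diagonal_mul_diagonal, Matrix.trace_diagonal]
    push_cast
    refine Finset.sum_congr rfl fun i _ => ?_
    rw [← Complex.ofReal_mul]
    congr 1
    rcases eq_or_ne (s' i) 0 with h | h
    · rw [h, zero_mul, Real.zero_rpow hp0.ne']
    · have := Real.rpow_add (lt_of_le_of_ne (hs' i) (Ne.symm h)) 1 (p - 1)
      rw [Real.rpow_one, add_sub_cancel] at this
      exact this.symm
  have hb0 : 0 ≤ ∑ i, s' i ^ p := Finset.sum_nonneg fun i _ => Real.rpow_nonneg (hs' i) _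
  have ha0 : 0 ≤ ∑ i, s i ^ p := Finset.sum_nonneg fun i _ => Real.rpow_nonneg (hs i) _
  have hmain := hf.norm_le_interp (t := 1 / p) (by positivity)
    ((div_le_one hp0).2 hp.le) hleft hright
  rw [hval, Complex.norm_real, Real.norm_of_nonneg hb0] at hmain
  rcases hb0.eq_or_lt with h | h
  · rw [← h]
    exact ha0
  · rw [Real.rpow_sub h, Real.rpow_one, div_mul_eq_mul_div, le_div_iff₀ (Real.rpow_pos_of_pos h _),
      mul_le_mul_iff_right₀ h] at hmain
    exact (Real.rpow_le_rpow_iff hb0 ha0 (by positivity)).1 hmain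

lemma herPow_eq_conjPow {n : ℕ} {A : Matrix (Fin n) (Fin n) ℂ} (hA : A.PosDef) {t : ℝ}
    (ht : t ≠ 0) : herPow hA.1 t = conjPow hA.1.eigenvectorUnitary.1 hA.1.eigenvalues t := by
  simp only [herPow, conjPow, entirePow_ofReal (hA.eigenvalues_pos _).le ht]
  rfl

lemma conjPow_one {n : ℕ} {A : Matrix (Fin n) (Fin n) ℂ} (hA : A.PosDef) :
    conjPow hA.1.eigenvectorUnitary.1 hA.1.eigenvalues 1 = A := by
  conv_rhs => rw [hA.1.spectral_theorem, Unitary.conjStarAlgAut_apply]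
  have h := fun i => entirePow_ofReal (hA.eigenvalues_pos i).le one_ne_zero
  simp only [Complex.ofReal_one, Real.rpow_one] at h
  simp only [conjPow, h]
  rfl

end

/-- Finite-dimensional L^p-contraction: if `T` is a positive contraction on `Mₙ(ℂ)` with
`tr(ρ T(y)) ≤ tr(ρ y)` for PSD `y`, then for `1 < p < ∞` the Schatten `p`-norm of
`ρ^{1/(2p)} T(x) ρ^{1/(2p)}` is at most that of `ρ^{1/(2p)} x ρ^{1/(2p)}`. -/
theorem stmt8 (n : ℕ) (hn : 1 ≤ n) (ρ : Matrix (Fin n) (Fin n) ℂ)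
    (hρ : ρ.PosDef) (htr : ρ.trace = 1) (p : ℝ) (hp : 1 < p)
    (T : Matrix (Fin n) (Fin n) ℂ →ₗ[ℂ] Matrix (Fin n) (Fin n) ℂ)
    (hTcontr : ∀ x : Matrix (Fin n) (Fin n) ℂ, l2opNorm (T x) ≤ l2opNorm x)
    (hTpos : ∀ y : Matrix (Fin n) (Fin n) ℂ, y.PosSemidef → (T y).PosSemidef)
    (hTtr : ∀ y : Matrix (Fin n) (Fin n) ℂ, y.PosSemidef → (ρ * T y).trace ≤ (ρ * y).trace)
    (x : Matrix (Fin n) (Fin n) ℂ) :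
    (herPow (Matrix.posSemidef_conjTranspose_mul_self
        (herPow hρ.1 (1 / (2 * p)) * T x * herPow hρ.1 (1 / (2 * p)))).1 (p / 2)).trace ≤
      (herPow (Matrix.posSemidef_conjTranspose_mul_self
        (herPow hρ.1 (1 / (2 * p)) * x * herPow hρ.1 (1 / (2 * p)))).1 (p / 2)).trace := by
  obtain ⟨U, hU, V, hV, s, hs, hx, hsp⟩ :=
    exists_svd (herPow hρ.1 (1 / (2 * p)) * x * herPow hρ.1 (1 / (2 * p)))
  obtain ⟨U', hU', V', hV', s', hs', hTx, hsp'⟩ :=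
    exists_svd (herPow hρ.1 (1 / (2 * p)) * T x * herPow hρ.1 (1 / (2 * p)))
  rw [hsp, hsp']
  have ht : 1 / (2 * p) ≠ 0 := by positivity
  rw [herPow_eq_conjPow hρ ht] at hx hTx
  have h1 := conjPow_one hρ
  exact_mod_cast sum_rpow_le_of_interpolation hρ.1.eigenvectorUnitary.2
    (fun i => (hρ.eigenvalues_pos i).ne') hp T hTcontr hTpos
    (by rw [h1]; exact hTtr) hU hV hU' hV' hs hs' x hx hTx
end
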